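/- Let β > 0, let p, q ∈ (1,∞) with p ≠ q, let A, B ∈ (0,∞), and assume the complementary regime: (q ≤ α_p or B/A < r₂) and (p ≤ α_q or B/A > r₁). Then the variational problem sup_{v ∈ 𝒞} ∫₀^∞ G(v(t)) dt has a unique maximizer (up to equality almost everywhere), given by u(t) = 4π·max{(λ₁t^{p−1}+λ₂t^{q−1})^{−1/(2β+1)} − 1, 0}, where λ₁, λ₂ > 0 are uniquely determined by the conditions p∫₀^∞ t^{p−1}u(t)dt = A^p and q∫₀^∞ t^{q−1}u(t)dt = B^q. -/

import Mathlib

open MeasureTheory Real Set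
open scoped ENNReal

noncomputable section

/-- The function `G(s) = 1 - (1 + s/(4π))^(-2β)`. -/
def GFun (β s : ℝ) : ℝ := 1 - (1 + s / (4 * π)) ^ (-(2 * β))

/-- `α_r = (r-1)/(2β+1)`. -/
def alphaC (β r : ℝ) : ℝ := (r - 1) / (2 * β + 1)

/-- `σ_r = (r-1)/(2βr+1)`. -/
def sigmaC (β r : ℝ) : ℝ := (r - 1) / (2 * β * r + 1)

/-- The threshold `r₁ = (4π)^(1/q-1/p) (α_q/(p-α_q))^(-1/p) σ_q^(1/q)`. -/
def rOne (β p q : ℝ) : ℝ :=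
  (4 * π) ^ (1 / q - 1 / p) * (alphaC β q / (p - alphaC β q)) ^ (-(1 / p)) *
    sigmaC β q ^ (1 / q)

/-- The threshold `r₂ = (4π)^(1/q-1/p) (α_p/(q-α_p))^(1/q) σ_p^(-1/p)`. -/
def rTwo (β p q : ℝ) : ℝ :=
  (4 * π) ^ (1 / q - 1 / p) * (alphaC β p / (q - alphaC β p)) ^ (1 / q) *
    sigmaC β p ^ (-(1 / p))

/-- The admissible class `𝒞`: nonincreasing `v : (0,∞) → [0,∞)` with
`p ∫₀^∞ t^(p-1) v(t) dt ≤ A^p` and `q ∫₀^∞ t^(q-1) v(t) dt ≤ B^q`. -/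
def classC (p q A B : ℝ) : Set (ℝ → ℝ) :=
  {v | (∀ t ∈ Ioi (0 : ℝ), 0 ≤ v t) ∧ AntitoneOn v (Ioi 0) ∧
    ENNReal.ofReal p * ∫⁻ t in Ioi (0 : ℝ), ENNReal.ofReal (t ^ (p - 1) * v t) ≤
      ENNReal.ofReal (A ^ p) ∧
    ENNReal.ofReal q * ∫⁻ t in Ioi (0 : ℝ), ENNReal.ofReal (t ^ (q - 1) * v t) ≤
      ENNReal.ofReal (B ^ q)}

/-- The objective functional `v ↦ ∫₀^∞ G(v(t)) dt` (as an extended-real integral). -/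
def varObj (β : ℝ) (v : ℝ → ℝ) : ℝ≥0∞ :=
  ∫⁻ t in Ioi (0 : ℝ), ENNReal.ofReal (GFun β (v t))

/-- The candidate extremal `4π max{(a t^(p-1) + b t^(q-1))^(-g) - 1, 0}`. -/
def profile (g p q a b t : ℝ) : ℝ :=
  4 * π * max ((a * t ^ (p - 1) + b * t ^ (q - 1)) ^ (-g) - 1) 0

/-- The `r`-th moment of the extremal profile normalised to have support `[0, 1]`. -/
def profileMoment (g p q r θ : ℝ) : ℝ :=
  ∫ s in Ioc (0 : ℝ) 1, s ^ (r - 1) * profile g p q (1 - θ) θ s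

lemma profile_comm (g p q a b t : ℝ) : profile g p q a b t = profile g q p b a t := by
  simp only [profile, add_comm]

lemma profileMoment_comm (g p q r θ : ℝ) :
    profileMoment g p q r θ = profileMoment g q p r (1 - θ) := by
  simp only [profileMoment, profile_comm g p q, sub_sub_cancel]

lemma profile_nonneg (g p q a b t : ℝ) : 0 ≤ profile g p q a b t := by
  unfold profile; positivity

lemma measurable_profile (g p q a b : ℝ) : Measurable (profile g p q a b) := by
  unfold profile; fun_prop

lemma weight_pos {a b : ℝ} (ha : 0 < a) (hb : 0 ≤ b) (p q : ℝ) {t : ℝ} (ht : 0 < t) :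
    0 < a * t ^ (p - 1) + b * t ^ (q - 1) := by
  have := rpow_pos_of_pos ht (p - 1)
  have := rpow_pos_of_pos ht (q - 1)
  positivity

lemma profile_le {g p q a m b s : ℝ} (hg : 0 < g) (hm : 0 < m) (hma : m ≤ a) (hb : 0 ≤ b)
    (hs : 0 < s) : profile g p q a b s ≤ 4 * π * (m ^ (-g) * s ^ (-((p - 1) * g))) := by
  have h1 := rpow_pos_of_pos hs (p - 1)
  have h2 := rpow_pos_of_pos hs (q - 1)
  have h3 : (a * s ^ (p - 1) + b * s ^ (q - 1)) ^ (-g) ≤ m ^ (-g) * s ^ (-((p - 1) * g)) := by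
    have h4 : m ^ (-g) * s ^ (-((p - 1) * g)) = (m * s ^ (p - 1)) ^ (-g) := by
      rw [mul_rpow hm.le h1.le, ← rpow_mul hs.le]
      ring_nf
    rw [h4]
    refine rpow_le_rpow_of_nonpos (by positivity) ?_ (by linarith)
    have : m * s ^ (p - 1) ≤ a * s ^ (p - 1) := by gcongr
    have : 0 ≤ b * s ^ (q - 1) := by positivity
    linarith
  have h5 : 0 ≤ m ^ (-g) * s ^ (-((p - 1) * g)) := by positivity
  unfold profile
  gcongr
  exact max_le (by linarith) h5

lemma continuousOn_profile_param (g p q : ℝ) {s : ℝ} (hs : 0 < s) :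
    ContinuousOn (fun θ => profile g p q (1 - θ) θ s) (Ico 0 1) := by
  unfold profile
  refine ContinuousOn.mul continuousOn_const (ContinuousOn.sup (ContinuousOn.sub
    (ContinuousOn.rpow_const (by fun_prop) ?_) continuousOn_const) continuousOn_const)
  intro θ hθ
  exact Or.inl (weight_pos (by linarith [hθ.2]) hθ.1 p q hs).ne'

lemma integrableOn_profile_bound {g p r C : ℝ} (hr : (p - 1) * g < r) :
    IntegrableOn (fun s : ℝ => s ^ (r - 1) * (4 * π * (C * s ^ (-((p - 1) * g))))) (Ioc 0 1) := by
  have h : IntegrableOn (fun s : ℝ => s ^ (r - 1 - (p - 1) * g)) (Ioc 0 1) := by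
    rw [integrableOn_Ioc_iff_integrableOn_Ioo]
    exact (intervalIntegral.integrableOn_Ioo_rpow_iff one_pos).2 (by linarith)
  refine IntegrableOn.congr_fun (h.const_mul (4 * π * C)) (fun s hs => ?_) measurableSet_Ioc
  have : s ^ (r - 1 - (p - 1) * g) = s ^ (r - 1) * s ^ (-((p - 1) * g)) := by
    rw [← rpow_add hs.1]; ring_nf
  simp only [this]
  ring

lemma norm_mul_profile_le {g p q r m θ s : ℝ} (hg : 0 < g) (hm : m < 1)
    (hθ : θ ∈ Icc 0 m) (hs : 0 < s) :
    ‖s ^ (r - 1) * profile g p q (1 - θ) θ s‖ ≤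
      s ^ (r - 1) * (4 * π * ((1 - m) ^ (-g) * s ^ (-((p - 1) * g)))) := by
  have h1 := rpow_pos_of_pos hs (r - 1)
  rw [norm_of_nonneg (mul_nonneg h1.le (profile_nonneg ..))]
  gcongr
  exact profile_le hg (by linarith) (by linarith [hθ.2]) hθ.1 hs

lemma measurable_mul_profile (g p q r a b : ℝ) :
    Measurable fun s : ℝ => s ^ (r - 1) * profile g p q a b s :=
  (by fun_prop : Measurable fun s : ℝ => s ^ (r - 1)).mul (measurable_profile ..)

lemma integrableOn_mul_profile {g p q r θ : ℝ} (hg : 0 < g) (hr : (p - 1) * g < r)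
    (hθ : θ ∈ Ico 0 1) :
    IntegrableOn (fun s : ℝ => s ^ (r - 1) * profile g p q (1 - θ) θ s) (Ioc 0 1) := by
  refine Integrable.mono' (integrableOn_profile_bound (C := (1 - θ) ^ (-g)) hr)
    (measurable_mul_profile ..).aestronglyMeasurable ?_
  exact ae_restrict_of_forall_mem measurableSet_Ioc
    fun s hs => norm_mul_profile_le hg hθ.2 ⟨hθ.1, le_rfl⟩ hs.1

lemma continuousOn_profileMoment {g p r : ℝ} (q : ℝ) (hg : 0 < g) (hr : (p - 1) * g < r) :
    ContinuousOn (profileMoment g p q r) (Ico 0 1) := by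
  have key : ∀ m < 1, ContinuousOn (profileMoment g p q r) (Icc 0 m) := by
    intro m hm
    refine continuousOn_of_dominated
      (bound := fun s => s ^ (r - 1) * (4 * π * ((1 - m) ^ (-g) * s ^ (-((p - 1) * g)))))
      (fun θ _ => (measurable_mul_profile ..).aestronglyMeasurable) ?_
      (integrableOn_profile_bound hr) ?_
    · intro θ hθ
      exact ae_restrict_of_forall_mem measurableSet_Ioc
        fun s hs => norm_mul_profile_le hg hm hθ hs.1
    · refine ae_restrict_of_forall_mem measurableSet_Ioc fun s hs => ?_
      exact (continuousOn_const.mul (continuousOn_profile_param g p q hs.1)).mono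
        fun θ hθ => ⟨hθ.1, hθ.2.trans_lt hm⟩
  intro θ hθ
  have h1 : (θ + 1) / 2 < 1 := by linarith [hθ.2]
  have h2 := key _ h1 θ ⟨hθ.1, by linarith [hθ.2]⟩
  refine h2.mono_of_mem_nhdsWithin ?_
  have h3 : Iio ((θ + 1) / 2) ∈ nhds θ := Iio_mem_nhds (by linarith [hθ.2])
  filter_upwards [mem_nhdsWithin_of_mem_nhds h3, self_mem_nhdsWithin] with x hx hx'
  exact ⟨hx'.1, le_of_lt hx⟩

lemma profile_one_zero {g p q s : ℝ} (hg : 0 < g) (hp : 1 < p) (hs : s ∈ Ioc (0 : ℝ) 1) :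
    profile g p q 1 0 s = 4 * π * (s ^ (-((p - 1) * g)) - 1) := by
  have h1 : (1 : ℝ) ≤ s ^ (-((p - 1) * g)) :=
    one_le_rpow_of_pos_of_le_one_of_nonpos hs.1 hs.2 (by nlinarith)
  have h2 : (s ^ (p - 1)) ^ (-g) = s ^ (-((p - 1) * g)) := by
    rw [← rpow_mul hs.1.le]; ring_nf
  unfold profile
  rw [one_mul, zero_mul, add_zero, h2, max_eq_left (by linarith)]

lemma profileMoment_zero {g p q r : ℝ} (hg : 0 < g) (hp : 1 < p) (hr0 : 0 < r)
    (hr : (p - 1) * g < r) :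
    r * profileMoment g p q r 0 = 4 * π * ((p - 1) * g / (r - (p - 1) * g)) := by
  have h1 : profileMoment g p q r 0 =
      ∫ s in (0 : ℝ)..1, 4 * π * (s ^ (r - 1 - (p - 1) * g) - s ^ (r - 1)) := by
    rw [intervalIntegral.integral_of_le zero_le_one, profileMoment]
    refine setIntegral_congr_fun measurableSet_Ioc fun s hs => ?_
    simp only [sub_zero, profile_one_zero hg hp hs, sub_eq_add_neg (r - 1) ((p - 1) * g),
      rpow_add hs.1 (r - 1)]
    ring
  rw [h1, intervalIntegral.integral_const_mul, intervalIntegral.integral_sub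
    (intervalIntegral.intervalIntegrable_rpow' (by linarith))
    (intervalIntegral.intervalIntegrable_rpow' (by linarith)),
    integral_rpow (Or.inl (by linarith)), integral_rpow (Or.inl (by linarith))]
  have h2 : r - (p - 1) * g ≠ 0 := by linarith
  rw [zero_rpow (by linarith), zero_rpow (by linarith)]
  simp only [one_rpow, sub_add_cancel, sub_zero,
    show r - 1 - (p - 1) * g + 1 = r - (p - 1) * g by ring]
  field_simp
  ring

lemma weight_lt_one {p q θ s : ℝ} (hp : 1 < p) (hq : 1 < q) (hθ : θ ∈ Ico (0 : ℝ) 1)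
    (hs : s ∈ Ioo (0 : ℝ) 1) : (1 - θ) * s ^ (p - 1) + θ * s ^ (q - 1) < 1 := by
  have h1 : s ^ (p - 1) < 1 := rpow_lt_one hs.1.le hs.2 (by linarith)
  have h2 : s ^ (q - 1) < 1 := rpow_lt_one hs.1.le hs.2 (by linarith)
  nlinarith [hθ.1, hθ.2]

lemma one_le_weight {p q θ s : ℝ} (hp : 1 < p) (hq : 1 < q) (hθ : θ ∈ Icc (0 : ℝ) 1)
    (hs : 1 ≤ s) : 1 ≤ (1 - θ) * s ^ (p - 1) + θ * s ^ (q - 1) := by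
  have h1 : 1 ≤ s ^ (p - 1) := one_le_rpow hs (by linarith)
  have h2 : 1 ≤ s ^ (q - 1) := one_le_rpow hs (by linarith)
  nlinarith [hθ.1, hθ.2]

lemma profile_eq_zero {g p q a b t : ℝ} (hg : 0 < g)
    (h : 1 ≤ a * t ^ (p - 1) + b * t ^ (q - 1)) : profile g p q a b t = 0 := by
  have : (a * t ^ (p - 1) + b * t ^ (q - 1)) ^ (-g) ≤ 1 :=
    rpow_le_one_of_one_le_of_nonpos h (by linarith)
  unfold profile
  rw [max_eq_right (by linarith), mul_zero]

lemma profileMoment_pos {g p q r θ : ℝ} (hg : 0 < g) (hp : 1 < p) (hq : 1 < q)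
    (hr : (p - 1) * g < r) (hθ : θ ∈ Ico (0 : ℝ) 1) : 0 < profileMoment g p q r θ := by
  rw [profileMoment, ← intervalIntegral.integral_of_le zero_le_one]
  refine intervalIntegral.intervalIntegral_pos_of_pos_on
    ((intervalIntegrable_iff_integrableOn_Ioc_of_le zero_le_one).2
      (integrableOn_mul_profile hg hr hθ)) (fun s hs => ?_) one_pos
  have h1 : 1 < ((1 - θ) * s ^ (p - 1) + θ * s ^ (q - 1)) ^ (-g) :=
    one_lt_rpow_of_pos_of_lt_one_of_neg (weight_pos (by linarith [hθ.2]) hθ.1 p q hs.1)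
      (weight_lt_one hp hq hθ hs) (by linarith)
  have h2 := rpow_pos_of_pos hs.1 (r - 1)
  unfold profile
  have h3 : 0 < max (((1 - θ) * s ^ (p - 1) + θ * s ^ (q - 1)) ^ (-g) - 1) 0 :=
    lt_max_of_lt_left (by linarith)
  positivity

lemma lintegral_profile_eq_top {g p q r : ℝ} (hg : 0 < g) (hp : 1 < p) (hr0 : 0 < r)
    (hr : r ≤ (p - 1) * g) :
    ∫⁻ s in Ioc (0 : ℝ) 1, ENNReal.ofReal (s ^ (r - 1) * profile g p q 1 0 s) = ⊤ := by
  by_contra hne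
  have h1 : IntegrableOn (fun s : ℝ => s ^ (r - 1) * profile g p q 1 0 s) (Ioc 0 1) := by
    refine (lintegral_ofReal_ne_top_iff_integrable
      (measurable_mul_profile ..).aestronglyMeasurable ?_).1 hne
    exact ae_restrict_of_forall_mem measurableSet_Ioc
      fun s hs => mul_nonneg (rpow_nonneg hs.1.le _) (profile_nonneg ..)
  have h2 : IntegrableOn (fun s : ℝ => s ^ (r - 1)) (Ioc 0 1) := by
    rw [integrableOn_Ioc_iff_integrableOn_Ioo]
    exact (intervalIntegral.integrableOn_Ioo_rpow_iff one_pos).2 (by linarith)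
  have h3 : IntegrableOn (fun s : ℝ => s ^ (r - 1 - (p - 1) * g)) (Ioc 0 1) := by
    refine IntegrableOn.congr_fun ((h1.const_mul (4 * π)⁻¹).add h2) (fun s hs => ?_)
      measurableSet_Ioc
    simp only [Pi.add_apply, profile_one_zero hg hp hs,
      sub_eq_add_neg (r - 1) ((p - 1) * g), rpow_add hs.1 (r - 1)]
    have := pi_pos
    field_simp
    ring
  rw [integrableOn_Ioc_iff_integrableOn_Ioo,
    intervalIntegral.integrableOn_Ioo_rpow_iff one_pos] at h3
  linarith

lemma eventually_lt_profileMoment {g p q r : ℝ} (hg : 0 < g) (hp : 1 < p) (hr0 : 0 < r)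
    (hr : r ≤ (p - 1) * g) (M : ℝ) :
    ∀ᶠ θ in nhdsWithin (0 : ℝ) (Ioi 0), (q - 1) * g < r → M < profileMoment g p q r θ := by
  have hfatou := lintegral_liminf_le (μ := volume.restrict (Ioc (0 : ℝ) 1))
    (u := nhdsWithin (0 : ℝ) (Ioi 0))
    (f := fun θ s => ENNReal.ofReal (s ^ (r - 1) * profile g p q (1 - θ) θ s))
    fun θ => (measurable_mul_profile ..).ennreal_ofReal
  have hlim : ∀ s ∈ Ioc (0 : ℝ) 1, Filter.liminf
      (fun θ => ENNReal.ofReal (s ^ (r - 1) * profile g p q (1 - θ) θ s))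
      (nhdsWithin (0 : ℝ) (Ioi 0)) = ENNReal.ofReal (s ^ (r - 1) * profile g p q 1 0 s) := by
    intro s hs
    refine Filter.Tendsto.liminf_eq (ENNReal.tendsto_ofReal (Filter.Tendsto.const_mul _ ?_))
    have h1 := continuousOn_profile_param g p q hs.1 0 ⟨le_rfl, one_pos⟩
    have h2 := h1.mono_left (nhdsWithin_le_of_mem (t := Ioi 0) (a := (0 : ℝ)) (s := Ico 0 1)
      (by
        filter_upwards [mem_nhdsWithin_of_mem_nhds (Iio_mem_nhds one_pos),
          self_mem_nhdsWithin] with x hx hx'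
        exact ⟨le_of_lt (mem_Ioi.1 hx'), hx⟩))
    simpa using h2
  rw [setLIntegral_congr_fun measurableSet_Ioc hlim,
    lintegral_profile_eq_top hg hp hr0 hr, top_le_iff] at hfatou
  have hev := Filter.eventually_lt_of_lt_liminf (b := ENNReal.ofReal M)
    (by rw [hfatou]; exact ENNReal.ofReal_lt_top)
  filter_upwards [hev, mem_nhdsWithin_of_mem_nhds (Iio_mem_nhds one_pos),
    self_mem_nhdsWithin] with θ h1 h2 h3 hqr
  have hθ : (1 - θ) ∈ Ico (0 : ℝ) 1 := ⟨by linarith [mem_Iio.1 h2], by linarith [mem_Ioi.1 h3]⟩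
  have hintegrable := integrableOn_mul_profile (q := p) hg hqr hθ
  simp only [sub_sub_cancel, profile_comm g q p] at hintegrable
  rw [← ofReal_integral_eq_lintegral_ofReal hintegrable
    (ae_restrict_of_forall_mem measurableSet_Ioc
      fun s hs => mul_nonneg (rpow_nonneg hs.1.le _) (profile_nonneg ..))] at h1
  exact (ENNReal.ofReal_lt_ofReal_iff'.1 h1).1

lemma eventually_moment_ratio {g p q A B : ℝ} (hg : 0 < g) (hg1 : g < 1) (hp : 1 < p)
    (hq : 1 < q) (hA : 0 < A) (hB : 0 < B)
    (h : q ≤ (p - 1) * g ∨ (p - 1) * g < q ∧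
      B * (p * profileMoment g p q p 0) ^ (1 / p) <
        A * (q * profileMoment g p q q 0) ^ (1 / q)) :
    ∀ᶠ θ in nhdsWithin (0 : ℝ) (Ioi 0),
      B * (p * profileMoment g p q p θ) ^ (1 / p) <
        A * (q * profileMoment g p q q θ) ^ (1 / q) := by
  have hmem : Ico (0 : ℝ) 1 ∈ nhdsWithin (0 : ℝ) (Ioi 0) := by
    filter_upwards [mem_nhdsWithin_of_mem_nhds (Iio_mem_nhds one_pos),
      self_mem_nhdsWithin] with x hx hx'
    exact ⟨le_of_lt (mem_Ioi.1 hx'), hx⟩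
  have hlim : ∀ r, 0 < r → (p - 1) * g < r → Filter.Tendsto
      (fun θ => (r * profileMoment g p q r θ) ^ (1 / r)) (nhdsWithin (0 : ℝ) (Ioi 0))
      (nhds ((r * profileMoment g p q r 0) ^ (1 / r))) := by
    intro r hr0 hr
    have h1 := (continuousOn_profileMoment q hg hr 0 ⟨le_rfl, one_pos⟩).mono_left
      (nhdsWithin_le_of_mem hmem)
    exact (h1.const_mul r).rpow_const (Or.inr (by positivity))
  have hlp := (hlim p (by linarith) (by nlinarith)).const_mul B
  rcases h with h | ⟨h, hlt⟩
  · have h1 := hlp.eventually (gt_mem_nhds (lt_add_one _))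
    set L := B * (p * profileMoment g p q p 0) ^ (1 / p) + 1 with hL
    have hL0 : 0 < L := by
      have := profileMoment_pos (q := q) (r := p) hg hp hq (by nlinarith) ⟨le_rfl, one_pos⟩
      positivity
    filter_upwards [h1, eventually_lt_profileMoment (q := q) hg hp (by linarith : 0 < q) h
      ((L / A) ^ q / q)] with θ h2 h3
    have h4 := h3 (by nlinarith)
    rw [div_lt_iff₀ (by linarith)] at h4
    refine h2.trans ?_
    have h5 : ((L / A) ^ q) ^ (1 / q) < (q * profileMoment g p q q θ) ^ (1 / q) :=
      rpow_lt_rpow (by positivity) (by linarith) (by positivity)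
    rw [← rpow_mul (by positivity), mul_one_div_cancel (by linarith), rpow_one,
      div_lt_iff₀ hA] at h5
    linarith
  · exact hlp.eventually_lt ((hlim q (by linarith) h).const_mul A) hlt

lemma exists_moment_ratio_eq {g p q A B : ℝ} (hg : 0 < g) (hg1 : g < 1) (hp : 1 < p)
    (hq : 1 < q) (hA : 0 < A) (hB : 0 < B)
    (h₁ : q ≤ (p - 1) * g ∨ (p - 1) * g < q ∧
      B * (p * profileMoment g p q p 0) ^ (1 / p) <
        A * (q * profileMoment g p q q 0) ^ (1 / q))
    (h₂ : p ≤ (q - 1) * g ∨ (q - 1) * g < p ∧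
      A * (q * profileMoment g q p q 0) ^ (1 / q) <
        B * (p * profileMoment g q p p 0) ^ (1 / p)) :
    ∃ θ ∈ Ioo (0 : ℝ) 1, B * (p * profileMoment g p q p θ) ^ (1 / p) =
      A * (q * profileMoment g p q q θ) ^ (1 / q) := by
  have hmem : ∀ᶠ θ in nhdsWithin (0 : ℝ) (Ioi 0), θ ∈ Ioo (0 : ℝ) 1 := Ioo_mem_nhdsGT one_pos
  obtain ⟨x, hx, hx'⟩ :=
    ((eventually_moment_ratio hg hg1 hp hq hA hB h₁).and hmem).exists
  obtain ⟨y, hy, hy'⟩ :=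
    ((eventually_moment_ratio hg hg1 hq hp hB hA h₂).and hmem).exists
  rw [profileMoment_comm g q p, profileMoment_comm g q p] at hy
  have hcp : ContinuousOn (profileMoment g p q p) (Ioo 0 1) :=
    (continuousOn_profileMoment q hg (by nlinarith)).mono Ioo_subset_Ico_self
  have hcq : ContinuousOn (profileMoment g p q q) (Ioo 0 1) := by
    have h1 := (continuousOn_profileMoment (g := g) (p := q) (r := q) p hg (by nlinarith)).comp
      (f := fun θ : ℝ => 1 - θ) (s := Ioo 0 1) (by fun_prop)
      fun θ hθ => ⟨by linarith [hθ.2], by linarith [hθ.1]⟩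
    exact h1.congr fun θ _ => profileMoment_comm g p q q θ
  refine isPreconnected_Ioo.intermediate_value₂ hx' (b := 1 - y)
    ⟨by linarith [hy'.2], by linarith [hy'.1]⟩ ?_ ?_ hx.le hy.le
  · exact continuousOn_const.mul ((continuousOn_const.mul hcp).rpow_const
      fun _ _ => Or.inr (by positivity))
  · exact continuousOn_const.mul ((continuousOn_const.mul hcq).rpow_const
      fun _ _ => Or.inr (by positivity))

lemma integral_mul_profile_scaled {g p q r T θ : ℝ} (hg : 0 < g) (hp : 1 < p) (hq : 1 < q)
    (hT : 0 < T) (hθ : θ ∈ Icc (0 : ℝ) 1) :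
    ∫ t in Ioi (0 : ℝ), t ^ (r - 1) *
        profile g p q ((1 - θ) * T ^ (-(p - 1))) (θ * T ^ (-(q - 1))) t =
      T ^ r * profileMoment g p q r θ := by
  have h1 := integral_comp_mul_left_Ioi (fun t => t ^ (r - 1) *
    profile g p q ((1 - θ) * T ^ (-(p - 1))) (θ * T ^ (-(q - 1))) t) 0 hT
  have hcancel : ∀ e : ℝ, T ^ (-e) * T ^ e = 1 := fun e => by
    rw [← rpow_add hT, neg_add_cancel, rpow_zero]
  have h2 : ∫ s in Ioi (0 : ℝ), (T * s) ^ (r - 1) *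
      profile g p q ((1 - θ) * T ^ (-(p - 1))) (θ * T ^ (-(q - 1))) (T * s) =
      T ^ (r - 1) * ∫ s in Ioi (0 : ℝ), s ^ (r - 1) * profile g p q (1 - θ) θ s := by
    rw [← integral_const_mul]
    refine setIntegral_congr_fun measurableSet_Ioi fun s hs => ?_
    have hs' : (0 : ℝ) ≤ s := le_of_lt hs
    simp only [profile, mul_rpow hT.le hs']
    have e1 : (1 - θ) * T ^ (-(p - 1)) * (T ^ (p - 1) * s ^ (p - 1)) = (1 - θ) * s ^ (p - 1) := by
      linear_combination (1 - θ) * s ^ (p - 1) * hcancel (p - 1)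
    have e2 : θ * T ^ (-(q - 1)) * (T ^ (q - 1) * s ^ (q - 1)) = θ * s ^ (q - 1) := by
      linear_combination θ * s ^ (q - 1) * hcancel (q - 1)
    rw [e1, e2]
    ring
  have h3 : ∫ s in Ioi (0 : ℝ), s ^ (r - 1) * profile g p q (1 - θ) θ s =
      profileMoment g p q r θ := by
    refine setIntegral_eq_of_subset_of_forall_sdiff_eq_zero measurableSet_Ioi
      Ioc_subset_Ioi_self fun s hs => ?_
    have h4 : 1 ≤ s := by
      by_contra hlt
      exact hs.2 ⟨hs.1, by linarith⟩
    rw [profile_eq_zero hg (one_le_weight hp hq hθ h4), mul_zero]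
  rw [h2, h3, mul_zero, smul_eq_mul, rpow_sub_one hT.ne'] at h1
  field_simp at h1
  linarith

lemma exists_profile_params {g p q A B : ℝ} (hg : 0 < g) (hg1 : g < 1) (hp : 1 < p)
    (hq : 1 < q) (hA : 0 < A) (hB : 0 < B)
    (h₁ : q ≤ (p - 1) * g ∨ (p - 1) * g < q ∧
      B * (p * profileMoment g p q p 0) ^ (1 / p) <
        A * (q * profileMoment g p q q 0) ^ (1 / q))
    (h₂ : p ≤ (q - 1) * g ∨ (q - 1) * g < p ∧
      A * (q * profileMoment g q p q 0) ^ (1 / q) <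
        B * (p * profileMoment g q p p 0) ^ (1 / p)) :
    ∃ a b : ℝ, 0 < a ∧ 0 < b ∧
      p * ∫ t in Ioi (0 : ℝ), t ^ (p - 1) * profile g p q a b t = A ^ p ∧
      q * ∫ t in Ioi (0 : ℝ), t ^ (q - 1) * profile g p q a b t = B ^ q := by
  obtain ⟨θ, hθ, h⟩ := exists_moment_ratio_eq hg hg1 hp hq hA hB h₁ h₂
  have hP : 0 < profileMoment g p q p θ :=
    profileMoment_pos hg hp hq (by nlinarith) ⟨hθ.1.le, hθ.2⟩
  have hQ : 0 < profileMoment g p q q θ := by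
    rw [profileMoment_comm]
    exact profileMoment_pos hg hq hp (by nlinarith) ⟨by linarith [hθ.2], by linarith [hθ.1]⟩
  have hp0 : 0 < p := by linarith
  have hq0 : 0 < q := by linarith
  have hroot : ∀ {r x : ℝ}, 0 < r → 0 < x → (x ^ (1 / r)) ^ r = x := fun hr hx => by
    rw [← rpow_mul hx.le, one_div_mul_cancel hr.ne', rpow_one]
  have hPr := rpow_pos_of_pos (mul_pos hp0 hP) (1 / p)
  have hQr := rpow_pos_of_pos (mul_pos hq0 hQ) (1 / q)
  set T := A / (p * profileMoment g p q p θ) ^ (1 / p) with hTdef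
  have hT : 0 < T := by positivity
  have hT2 : T = B / (q * profileMoment g p q q θ) ^ (1 / q) := by
    rw [hTdef, div_eq_div_iff hPr.ne' hQr.ne']
    exact h.symm
  refine ⟨(1 - θ) * T ^ (-(p - 1)), θ * T ^ (-(q - 1)),
    mul_pos (by linarith [hθ.2]) (rpow_pos_of_pos hT _), mul_pos hθ.1 (rpow_pos_of_pos hT _),
    ?_, ?_⟩
  · rw [integral_mul_profile_scaled hg hp hq hT ⟨hθ.1.le, hθ.2.le⟩, hTdef,
      div_rpow hA.le hPr.le, hroot hp0 (mul_pos hp0 hP)]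
    field_simp
  · rw [integral_mul_profile_scaled hg hp hq hT ⟨hθ.1.le, hθ.2.le⟩, hT2,
      div_rpow hB.le hQr.le, hroot hq0 (mul_pos hq0 hQ)]
    field_simp

lemma one_sub_mul_lt_rpow_neg {k r : ℝ} (hk : 0 < k) (hr : 0 < r) (hr1 : r ≠ 1) :
    1 - k * (r - 1) < r ^ (-k) := by
  have h1 := log_lt_sub_one_of_pos hr hr1
  have h2 := add_one_le_exp (log r * (-k))
  rw [rpow_def_of_pos hr]
  nlinarith

lemma rpow_neg_tangent_lt {k x y : ℝ} (hk : 0 < k) (hx : 0 < x) (hy : 0 < y) (hxy : x ≠ y) :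
    y ^ (-k) - k * y ^ (-k - 1) * (x - y) < x ^ (-k) := by
  have h1 := one_sub_mul_lt_rpow_neg hk (div_pos hx hy) (by rwa [Ne, div_eq_one_iff_eq hy.ne'])
  rw [div_rpow hx.le hy.le] at h1
  have h2 := rpow_pos_of_pos hy (-k)
  have h3 := mul_lt_mul_of_pos_left h1 h2
  rw [mul_div_cancel₀ _ h2.ne'] at h3
  rw [rpow_sub_one hy.ne']
  refine lt_of_eq_of_lt ?_ h3
  field_simp

/-- Pointwise strict optimality of `4π max{w^(-1/(2β+1)) - 1, 0}` for the Lagrangian. -/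
lemma GFun_add_lt {β w s : ℝ} (hβ : 0 < β) (hw : 0 < w) (hs : 0 ≤ s)
    (hne : s ≠ 4 * π * max (w ^ (-(1 / (2 * β + 1))) - 1) 0) :
    GFun β s + 2 * β / (4 * π) * (w * (4 * π * max (w ^ (-(1 / (2 * β + 1))) - 1) 0)) <
      GFun β (4 * π * max (w ^ (-(1 / (2 * β + 1))) - 1) 0) + 2 * β / (4 * π) * (w * s) := by
  have hpi := pi_pos
  set m := max (w ^ (-(1 / (2 * β + 1))) - 1) 0 with hm
  have hm0 : 0 ≤ m := le_max_right _ _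
  have hy : 1 + 4 * π * m / (4 * π) = 1 + m := by field_simp
  have hx1 : 0 ≤ s / (4 * π) := by positivity
  have key := rpow_neg_tangent_lt (k := 2 * β) (x := 1 + s / (4 * π)) (y := 1 + m)
    (by linarith) (by linarith) (by linarith) (by
      intro h
      apply hne
      have : s / (4 * π) = m := by linarith
      rw [← this]; field_simp)
  have hcmp : (1 + m) ^ (-(2 * β) - 1) * ((1 + s / (4 * π)) - (1 + m)) ≤
      w * ((1 + s / (4 * π)) - (1 + m)) := by
    rcases le_total 1 w with h | h
    · have h1 : m = 0 := max_eq_right (by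
        have := rpow_le_one_of_one_le_of_nonpos h
          (show -(1 / (2 * β + 1)) ≤ 0 by rw [neg_nonpos]; positivity)
        linarith)
      rw [h1, add_zero, one_rpow]
      apply mul_le_mul_of_nonneg_right h
      linarith
    · have h1 : 1 + m = w ^ (-(1 / (2 * β + 1))) := by
        have := one_le_rpow_of_pos_of_le_one_of_nonpos hw h
          (show -(1 / (2 * β + 1)) ≤ 0 by rw [neg_nonpos]; positivity)
        rw [hm, max_eq_left (by linarith)]; ring
      have h2 : (1 + m) ^ (-(2 * β) - 1) = w := by
        rw [h1, ← rpow_mul hw.le]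
        have : -(1 / (2 * β + 1)) * (-(2 * β) - 1) = 1 := by field_simp; ring
        rw [this, rpow_one]
      rw [h2]
  have hfin : 2 * β / (4 * π) * (w * s) - 2 * β / (4 * π) * (w * (4 * π * m)) =
      2 * β * (w * ((1 + s / (4 * π)) - (1 + m))) := by
    field_simp; ring
  unfold GFun
  rw [hy]
  nlinarith

lemma GFun_nonneg {β s : ℝ} (hβ : 0 < β) (hs : 0 ≤ s) : 0 ≤ GFun β s := by
  have hpi := pi_pos
  have h1 : (1 : ℝ) ≤ 1 + s / (4 * π) := by
    have : 0 ≤ s / (4 * π) := by positivity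
    linarith
  have := rpow_le_one_of_one_le_of_nonpos h1 (show -(2 * β) ≤ 0 by linarith)
  unfold GFun; linarith

lemma GFun_le_one {β s : ℝ} (hs : 0 ≤ s) : GFun β s ≤ 1 := by
  have := pi_pos
  have h : 0 ≤ (1 + s / (4 * π)) ^ (-(2 * β)) := by positivity
  unfold GFun; linarith

lemma GFun_le_mul {β s : ℝ} (hβ : 0 < β) (hs : 0 ≤ s) : GFun β s ≤ 2 * β / (4 * π) * s := by
  rcases hs.eq_or_lt with rfl | hs'
  · simp [GFun]
  · have h := GFun_add_lt (w := 1) hβ one_pos hs (by simpa using hs'.ne')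
    simp only [one_rpow, sub_self, max_self, mul_zero, add_zero, one_mul] at h
    simpa [GFun] using h.le

lemma measurable_GFun (β : ℝ) : Measurable (GFun β) := by
  unfold GFun; fun_prop

lemma ofReal_mul_lintegral_profile {g p q a b r C : ℝ} (hr : 0 < r) (hC : 0 < C)
    (h : r * ∫ t in Ioi (0 : ℝ), t ^ (r - 1) * profile g p q a b t = C) :
    ENNReal.ofReal r *
      ∫⁻ t in Ioi (0 : ℝ), ENNReal.ofReal (t ^ (r - 1) * profile g p q a b t) =
      ENNReal.ofReal C := by
  have hintegrable : IntegrableOn (fun t => t ^ (r - 1) * profile g p q a b t) (Ioi 0) := by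
    by_contra hn
    rw [integral_undef hn, mul_zero] at h
    exact hC.ne h
  rw [← ofReal_integral_eq_lintegral_ofReal hintegrable
    (ae_restrict_of_forall_mem measurableSet_Ioi
      fun s hs => mul_nonneg (rpow_nonneg (le_of_lt hs) _) (profile_nonneg ..)),
    ← ENNReal.ofReal_mul hr.le, h]

lemma profile_antitoneOn {g p q a b : ℝ} (hg : 0 < g) (hp : 1 < p) (hq : 1 < q) (ha : 0 < a)
    (hb : 0 < b) : AntitoneOn (profile g p q a b) (Ioi 0) := by
  intro s hs t ht hst
  have hs' : (0 : ℝ) < s := hs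
  have h1 : s ^ (p - 1) ≤ t ^ (p - 1) := rpow_le_rpow hs'.le hst (by linarith)
  have h2 : s ^ (q - 1) ≤ t ^ (q - 1) := rpow_le_rpow hs'.le hst (by linarith)
  have h3 : (a * t ^ (p - 1) + b * t ^ (q - 1)) ^ (-g) ≤
      (a * s ^ (p - 1) + b * s ^ (q - 1)) ^ (-g) :=
    rpow_le_rpow_of_nonpos (weight_pos ha hb.le p q hs') (by gcongr) (by linarith)
  unfold profile
  gcongr

lemma profile_mem_classC {g p q a b A B : ℝ} (hg : 0 < g) (hp : 1 < p) (hq : 1 < q)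
    (ha : 0 < a) (hb : 0 < b) (hA : 0 < A) (hB : 0 < B)
    (h₁ : p * ∫ t in Ioi (0 : ℝ), t ^ (p - 1) * profile g p q a b t = A ^ p)
    (h₂ : q * ∫ t in Ioi (0 : ℝ), t ^ (q - 1) * profile g p q a b t = B ^ q) :
    profile g p q a b ∈ classC p q A B :=
  ⟨fun _ _ => profile_nonneg .., profile_antitoneOn hg hp hq ha hb,
    (ofReal_mul_lintegral_profile (by linarith) (by positivity) h₁).le,
    (ofReal_mul_lintegral_profile (by linarith) (by positivity) h₂).le⟩

lemma lintegral_weight_mul {p q a b c : ℝ} {v : ℝ → ℝ} (hp : 0 < p) (hq : 0 < q) (ha : 0 < a)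
    (hb : 0 < b) (hc : 0 < c) (hv : ∀ t ∈ Ioi (0 : ℝ), 0 ≤ v t)
    (hm : AEMeasurable v (volume.restrict (Ioi 0))) :
    ∫⁻ t in Ioi (0 : ℝ), ENNReal.ofReal (c * ((a * t ^ (p - 1) + b * t ^ (q - 1)) * v t)) =
      ENNReal.ofReal (c * a / p) *
        (ENNReal.ofReal p * ∫⁻ t in Ioi (0 : ℝ), ENNReal.ofReal (t ^ (p - 1) * v t)) +
      ENNReal.ofReal (c * b / q) *
        (ENNReal.ofReal q * ∫⁻ t in Ioi (0 : ℝ), ENNReal.ofReal (t ^ (q - 1) * v t)) := by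
  have hmr : ∀ r : ℝ, AEMeasurable (fun t => ENNReal.ofReal (t ^ (r - 1) * v t))
      (volume.restrict (Ioi 0)) := fun r =>
    ((by fun_prop : Measurable fun t : ℝ => t ^ (r - 1)).aemeasurable.mul hm).ennreal_ofReal
  rw [← mul_assoc, ← mul_assoc, ← ENNReal.ofReal_mul (by positivity),
    ← ENNReal.ofReal_mul (by positivity), div_mul_cancel₀ _ hp.ne', div_mul_cancel₀ _ hq.ne',
    ← lintegral_const_mul'' _ (hmr p), ← lintegral_const_mul'' _ (hmr q),
    ← lintegral_add_left' ((hmr p).const_mul _)]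
  refine setLIntegral_congr_fun measurableSet_Ioi fun t ht => ?_
  have h0 := hv t ht
  have h1 := rpow_pos_of_pos (mem_Ioi.1 ht) (p - 1)
  have h2 := rpow_pos_of_pos (mem_Ioi.1 ht) (q - 1)
  rw [← ENNReal.ofReal_mul (by positivity), ← ENNReal.ofReal_mul (by positivity),
    ← ENNReal.ofReal_add (by positivity) (by positivity)]
  ring_nf

lemma aemeasurable_of_mem_classC {p q A B : ℝ} {v : ℝ → ℝ} (hv : v ∈ classC p q A B) :
    AEMeasurable v (volume.restrict (Ioi 0)) :=
  aemeasurable_restrict_of_antitoneOn measurableSet_Ioi hv.2.1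

lemma varObj_ne_top {β p q A B : ℝ} {v : ℝ → ℝ} (hβ : 0 < β) (hp : 1 < p)
    (hv : v ∈ classC p q A B) : varObj β v ≠ ⊤ := by
  have hpi := pi_pos
  have hm := aemeasurable_of_mem_classC hv
  have hle : varObj β v ≤ ∫⁻ t in Ioi (0 : ℝ), ((Ioc (0 : ℝ) 1).indicator 1 t +
      ENNReal.ofReal (2 * β / (4 * π)) * ENNReal.ofReal (t ^ (p - 1) * v t)) := by
    refine setLIntegral_mono' measurableSet_Ioi fun t ht => ?_
    have ht' : (0 : ℝ) < t := ht
    have h0 := hv.1 t ht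
    rcases le_or_gt t 1 with h | h
    · rw [indicator_of_mem (show t ∈ Ioc (0 : ℝ) 1 from ⟨ht', h⟩), Pi.one_apply]
      refine le_trans ?_ le_self_add
      rw [← ENNReal.ofReal_one]
      exact ENNReal.ofReal_le_ofReal (GFun_le_one h0)
    · refine le_trans ?_ le_add_self
      rw [← ENNReal.ofReal_mul (by positivity)]
      refine ENNReal.ofReal_le_ofReal ((GFun_le_mul hβ h0).trans ?_)
      have h1 : 1 ≤ t ^ (p - 1) := one_le_rpow h.le (by linarith)
      have h2 : v t ≤ t ^ (p - 1) * v t := le_mul_of_one_le_left h0 h1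
      gcongr
  refine ne_top_of_le_ne_top ?_ hle
  rw [lintegral_add_left (measurable_one.indicator measurableSet_Ioc),
    lintegral_const_mul' _ _ ENNReal.ofReal_ne_top, lintegral_indicator_one measurableSet_Ioc]
  refine ENNReal.add_ne_top.2 ⟨?_, ENNReal.mul_ne_top ENNReal.ofReal_ne_top fun htop => ?_⟩
  · exact ne_top_of_le_ne_top (by simp) (Measure.restrict_apply_le (Ioi (0 : ℝ)) (Ioc (0 : ℝ) 1))
  · have h := hv.2.2.1
    rw [htop, ENNReal.mul_top (by simpa using (by linarith : 0 < p))] at h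
    exact ENNReal.ofReal_ne_top (top_le_iff.1 h)

lemma profile_optimal {β p q a b A B : ℝ} (hβ : 0 < β) (hp : 1 < p) (hq : 1 < q)
    (ha : 0 < a) (hb : 0 < b) (hA : 0 < A) (hB : 0 < B)
    (h₁ : p * ∫ t in Ioi (0 : ℝ), t ^ (p - 1) * profile (1 / (2 * β + 1)) p q a b t = A ^ p)
    (h₂ : q * ∫ t in Ioi (0 : ℝ), t ^ (q - 1) * profile (1 / (2 * β + 1)) p q a b t = B ^ q)
    {v : ℝ → ℝ} (hv : v ∈ classC p q A B) :
    varObj β v ≤ varObj β (profile (1 / (2 * β + 1)) p q a b) ∧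
      (varObj β v = varObj β (profile (1 / (2 * β + 1)) p q a b) →
        ∀ᵐ t ∂(volume.restrict (Ioi (0 : ℝ))), v t = profile (1 / (2 * β + 1)) p q a b t) := by
  have hpi := pi_pos
  have hp0 : 0 < p := by linarith
  have hq0 : 0 < q := by linarith
  have hg : 0 < 1 / (2 * β + 1) := by positivity
  set u := profile (1 / (2 * β + 1)) p q a b with hu
  have huC : u ∈ classC p q A B := profile_mem_classC hg hp hq ha hb hA hB h₁ h₂
  have hc : 0 < 2 * β / (4 * π) := by positivity
  have hvm := aemeasurable_of_mem_classC hv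
  have hum := aemeasurable_of_mem_classC huC
  set w : ℝ → ℝ := fun t => a * t ^ (p - 1) + b * t ^ (q - 1) with hw
  have hwm : Measurable w := by fun_prop
  set S : (ℝ → ℝ) → ℝ≥0∞ := fun f =>
    ∫⁻ t in Ioi (0 : ℝ), ENNReal.ofReal (2 * β / (4 * π) * (w t * f t)) with hS
  have hSu : S u = ENNReal.ofReal (2 * β / (4 * π) * a / p) * ENNReal.ofReal (A ^ p) +
      ENNReal.ofReal (2 * β / (4 * π) * b / q) * ENNReal.ofReal (B ^ q) := by
    rw [hS]
    simp only [hw]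
    rw [lintegral_weight_mul hp0 hq0 ha hb hc huC.1 hum,
      ofReal_mul_lintegral_profile hp0 (by positivity) h₁,
      ofReal_mul_lintegral_profile hq0 (by positivity) h₂]
  have hSv : S v ≤ S u := by
    rw [hSu, hS]
    simp only [hw]
    rw [lintegral_weight_mul hp0 hq0 ha hb hc hv.1 hvm]
    exact add_le_add (mul_le_mul_right hv.2.2.1 _) (mul_le_mul_right hv.2.2.2 _)
  have hSu_top : S u ≠ ⊤ := by
    rw [hSu]
    exact ENNReal.add_ne_top.2 ⟨ENNReal.mul_ne_top ENNReal.ofReal_ne_top ENNReal.ofReal_ne_top,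
      ENNReal.mul_ne_top ENNReal.ofReal_ne_top ENNReal.ofReal_ne_top⟩
  have hGm : ∀ {f : ℝ → ℝ}, AEMeasurable f (volume.restrict (Ioi 0)) →
      AEMeasurable (fun t => ENNReal.ofReal (GFun β (f t))) (volume.restrict (Ioi 0)) :=
    fun hf => ((measurable_GFun β).comp_aemeasurable hf).ennreal_ofReal
  have hadd : ∀ f g : ℝ → ℝ, AEMeasurable f (volume.restrict (Ioi 0)) →
      (∫⁻ t in Ioi (0 : ℝ), (ENNReal.ofReal (GFun β (f t)) +
        ENNReal.ofReal (2 * β / (4 * π) * (w t * g t)))) = varObj β f + S g :=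
    fun f g hf => lintegral_add_left' (hGm hf) _
  have hlt : ∀ t ∈ Ioi (0 : ℝ), v t ≠ u t →
      ENNReal.ofReal (GFun β (v t)) + ENNReal.ofReal (2 * β / (4 * π) * (w t * u t)) <
      ENNReal.ofReal (GFun β (u t)) + ENNReal.ofReal (2 * β / (4 * π) * (w t * v t)) := by
    intro t ht hne
    have hwt : 0 < w t := weight_pos ha hb.le p q ht
    have hv0 := hv.1 t ht
    have hu0 := huC.1 t ht
    have hgv := GFun_nonneg hβ hv0
    have hgu := GFun_nonneg hβ hu0
    have key : GFun β (v t) + 2 * β / (4 * π) * (w t * u t) <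
        GFun β (u t) + 2 * β / (4 * π) * (w t * v t) := GFun_add_lt hβ hwt hv0 hne
    rw [← ENNReal.ofReal_add hgv (by positivity), ← ENNReal.ofReal_add hgu (by positivity)]
    exact (ENNReal.ofReal_lt_ofReal_iff_of_nonneg (by positivity)).2 key
  have hle : ∀ t ∈ Ioi (0 : ℝ),
      ENNReal.ofReal (GFun β (v t)) + ENNReal.ofReal (2 * β / (4 * π) * (w t * u t)) ≤
      ENNReal.ofReal (GFun β (u t)) + ENNReal.ofReal (2 * β / (4 * π) * (w t * v t)) := by
    intro t ht
    by_cases h : v t = u t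
    · rw [h]
    · exact (hlt t ht h).le
  have hle' := setLIntegral_mono' (μ := volume) measurableSet_Ioi hle
  rw [hadd v u hvm, hadd u v hum] at hle'
  refine ⟨(ENNReal.add_le_add_iff_right hSu_top).1 (hle'.trans (by gcongr)), fun heq => ?_⟩
  have hae := ae_eq_of_ae_le_of_lintegral_le (ae_restrict_of_forall_mem measurableSet_Ioi hle)
    (by
      rw [hadd v u hvm]
      exact ENNReal.add_ne_top.2 ⟨varObj_ne_top hβ hp hv, hSu_top⟩)
    ((hGm hum).add ((hwm.aemeasurable.mul hvm).const_mul _).ennreal_ofReal)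
    (by
      rw [hadd v u hvm, hadd u v hum, heq]
      gcongr)
  filter_upwards [hae, ae_restrict_mem measurableSet_Ioi] with t h1 ht
  by_contra hne
  exact (hlt t ht hne).ne h1

lemma continuousOn_profile {g p q a b : ℝ} (ha : 0 < a) (hb : 0 < b) :
    ContinuousOn (profile g p q a b) (Ioi 0) := by
  have hr : ∀ e : ℝ, ContinuousOn (fun t : ℝ => t ^ e) (Ioi 0) := fun e =>
    continuousOn_id.rpow_const fun t ht => Or.inl (ne_of_gt ht)
  unfold profile
  exact continuousOn_const.mul (ContinuousOn.sup
    ((((continuousOn_const.mul (hr _)).add (continuousOn_const.mul (hr _))).rpow_const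
      fun t ht => Or.inl (weight_pos ha hb.le p q ht).ne').sub continuousOn_const)
    continuousOn_const)

lemma tendsto_weight {p q : ℝ} (a b : ℝ) (hp : 1 < p) (hq : 1 < q) :
    Filter.Tendsto (fun t : ℝ => a * t ^ (p - 1) + b * t ^ (q - 1))
      (nhdsWithin 0 (Ioi 0)) (nhds 0) := by
  have h : ContinuousAt (fun t : ℝ => a * t ^ (p - 1) + b * t ^ (q - 1)) 0 :=
    (continuousAt_const.mul (continuousAt_rpow_const _ _ (Or.inr (by linarith)))).add
      (continuousAt_const.mul (continuousAt_rpow_const _ _ (Or.inr (by linarith))))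
  have h2 := h.tendsto
  rw [zero_rpow (by linarith), zero_rpow (by linarith), mul_zero, mul_zero, add_zero] at h2
  exact h2.mono_left nhdsWithin_le_nhds

lemma coeff_eq_of_weight_eq {p q a b a' b' : ℝ} (hpq : p ≠ q)
    (h : ∀ᶠ t in nhdsWithin (0 : ℝ) (Ioi 0),
      a' * t ^ (p - 1) + b' * t ^ (q - 1) = a * t ^ (p - 1) + b * t ^ (q - 1)) :
    a' = a ∧ b' = b := by
  have key : ∀ᶠ t in nhdsWithin (0 : ℝ) (Ioi 0), (a' - a) = (b - b') * t ^ (q - p) := by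
    filter_upwards [h, self_mem_nhdsWithin] with t ht ht0
    have h1 := rpow_pos_of_pos (mem_Ioi.1 ht0) (p - 1)
    have h2 : t ^ (q - 1) = t ^ (q - p) * t ^ (p - 1) := by
      rw [← rpow_add (mem_Ioi.1 ht0)]; ring_nf
    rw [h2] at ht
    exact mul_right_cancel₀ h1.ne' (by linear_combination ht)
  obtain ⟨ε, hε, hsub⟩ := mem_nhdsGT_iff_exists_Ioo_subset.1 key
  have hε0 : (0 : ℝ) < ε := hε
  have e1 : (a' - a) = (b - b') * (ε / 2) ^ (q - p) :=
    hsub ⟨by linarith, by linarith⟩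
  have e2 : (a' - a) = (b - b') * (ε / 3) ^ (q - p) :=
    hsub ⟨by linarith, by linarith⟩
  have hne : (ε / 2) ^ (q - p) ≠ (ε / 3) ^ (q - p) := by
    intro heq
    have := (rpow_left_inj (by linarith) (by linarith) (sub_ne_zero.2 hpq.symm)).1 heq
    linarith
  have hb : b - b' = 0 := by
    have : (b - b') * ((ε / 2) ^ (q - p) - (ε / 3) ^ (q - p)) = 0 := by linear_combination e2 - e1
    exact (mul_eq_zero.1 this).resolve_right (sub_ne_zero.2 hne)
  rw [hb, zero_mul] at e1
  exact ⟨by linarith, by linarith⟩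

lemma profile_params_unique {g p q a b a' b' : ℝ} (hg : 0 < g) (hp : 1 < p) (hq : 1 < q)
    (hpq : p ≠ q) (ha : 0 < a) (hb : 0 < b) (ha' : 0 < a') (hb' : 0 < b')
    (h : ∀ᵐ t ∂(volume.restrict (Ioi (0 : ℝ))), profile g p q a' b' t = profile g p q a b t) :
    a' = a ∧ b' = b := by
  have heq := Measure.eqOn_open_of_ae_eq h isOpen_Ioi (continuousOn_profile ha' hb')
    (continuousOn_profile ha hb)
  refine coeff_eq_of_weight_eq (p := p) (q := q) hpq ?_
  filter_upwards [self_mem_nhdsWithin, (tendsto_weight a b hp hq).eventually (gt_mem_nhds one_pos),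
    (tendsto_weight a' b' hp hq).eventually (gt_mem_nhds one_pos)] with t ht h1 h2
  have hpi := pi_pos
  have hw := weight_pos ha hb.le p q ht
  have hw' := weight_pos ha' hb'.le p q ht
  have h3 := one_lt_rpow_of_pos_of_lt_one_of_neg hw h1 (neg_lt_zero.2 hg)
  have h4 := one_lt_rpow_of_pos_of_lt_one_of_neg hw' h2 (neg_lt_zero.2 hg)
  have h5 := heq ht
  unfold profile at h5
  rw [max_eq_left (by linarith), max_eq_left (by linarith)] at h5
  have h6 := mul_left_cancel₀ (by positivity) h5
  exact (rpow_left_inj hw'.le hw.le (neg_ne_zero.2 hg.ne')).1 (by linarith)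

lemma alphaC_eq (β r : ℝ) : alphaC β r = (r - 1) * (1 / (2 * β + 1)) := by
  rw [alphaC, mul_one_div]

lemma alphaC_div_eq_sigmaC {β r : ℝ} (hβ : 0 < β) (hr : 1 < r) :
    alphaC β r / (r - alphaC β r) = sigmaC β r := by
  have h1 : r - alphaC β r = (2 * β * r + 1) / (2 * β + 1) := by
    rw [alphaC]; field_simp; ring
  rw [h1, alphaC, sigmaC]
  have : 0 < 2 * β * r + 1 := by positivity
  field_simp

lemma rOne_eq_inv_rTwo {β p q : ℝ} (hβ : 0 < β) (hq : 1 < q)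
    (h : alphaC β q < p) : rOne β p q = (rTwo β q p)⁻¹ := by
  have hpi := pi_pos
  have h1 : 0 < sigmaC β q := div_pos (by linarith) (by positivity)
  have h2 : 0 < alphaC β q / (p - alphaC β q) :=
    div_pos (div_pos (by linarith) (by linarith)) (by linarith)
  rw [rOne, rTwo, mul_inv, mul_inv, ← rpow_neg (by positivity), ← rpow_neg h2.le,
    ← rpow_neg h1.le, neg_neg, neg_sub]

lemma moment_ratio_zero_lt {β p q A B : ℝ} (hβ : 0 < β) (hp : 1 < p) (hq : 1 < q)
    (hA : 0 < A) (h : alphaC β p < q) (hlt : B / A < rTwo β p q) :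
    B * (p * profileMoment (1 / (2 * β + 1)) p q p 0) ^ (1 / p) <
      A * (q * profileMoment (1 / (2 * β + 1)) p q q 0) ^ (1 / q) := by
  have hpi := pi_pos
  have hg : 0 < 1 / (2 * β + 1) := by positivity
  have hα0 : 0 < alphaC β p := div_pos (by linarith) (by linarith)
  have hαp : alphaC β p < p := by
    rw [alphaC, div_lt_iff₀ (by linarith)]; nlinarith
  have h1 : 0 < sigmaC β p := div_pos (by linarith) (by positivity)
  have h2 : 0 < alphaC β p / (q - alphaC β p) := div_pos hα0 (by linarith)
  rw [profileMoment_zero hg hp (by linarith) (by rwa [← alphaC_eq]),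
    profileMoment_zero hg hp (by linarith) (by rwa [← alphaC_eq]), ← alphaC_eq,
    alphaC_div_eq_sigmaC hβ hp, mul_rpow (by positivity) h1.le, mul_rpow (by positivity) h2.le]
  rw [rTwo, div_lt_iff₀ hA, rpow_sub (by positivity), rpow_neg h1.le] at hlt
  have h3 : 0 < (4 * π) ^ (1 / p) := by positivity
  have h4 : 0 < sigmaC β p ^ (1 / p) := by positivity
  have h5 := mul_lt_mul_of_pos_right hlt (mul_pos h3 h4)
  refine h5.trans_eq ?_
  field_simp

/-- In the complementary regime, the variational problem
`sup_{v ∈ 𝒞} ∫₀^∞ G(v(t)) dt` has a unique (up to a.e. equality) maximizer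
`u(t) = 4π max{(λ₁ t^(p-1) + λ₂ t^(q-1))^(-1/(2β+1)) - 1, 0}`, where `λ₁, λ₂ > 0` are
uniquely determined by equality in both constraints. -/
theorem variational_problem_unique_maximizer
    (β p q A B : ℝ) (hβ : 0 < β)
    (hp : 1 < p) (hq : 1 < q) (hpq : p ≠ q) (hA : 0 < A) (hB : 0 < B)
    (hreg₁ : q ≤ alphaC β p ∨ B / A < rTwo β p q)
    (hreg₂ : p ≤ alphaC β q ∨ rOne β p q < B / A) :
    ∃ lam₁ lam₂ : ℝ, 0 < lam₁ ∧ 0 < lam₂ ∧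
      (let u : ℝ → ℝ := fun t =>
        4 * π * max ((lam₁ * t ^ (p - 1) + lam₂ * t ^ (q - 1)) ^ (-(1 / (2 * β + 1))) - 1) 0
      (p * ∫ t in Ioi (0 : ℝ), t ^ (p - 1) * u t = A ^ p) ∧
      (q * ∫ t in Ioi (0 : ℝ), t ^ (q - 1) * u t = B ^ q) ∧
      -- `λ₁, λ₂` are uniquely determined by these two equations
      (∀ lam₁' lam₂' : ℝ, 0 < lam₁' → 0 < lam₂' →
        (p * ∫ t in Ioi (0 : ℝ), t ^ (p - 1) *
            (4 * π * max ((lam₁' * t ^ (p - 1) + lam₂' * t ^ (q - 1)) ^ (-(1 / (2 * β + 1))) - 1) 0)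
          = A ^ p) →
        (q * ∫ t in Ioi (0 : ℝ), t ^ (q - 1) *
            (4 * π * max ((lam₁' * t ^ (p - 1) + lam₂' * t ^ (q - 1)) ^ (-(1 / (2 * β + 1))) - 1) 0)
          = B ^ q) →
        lam₁' = lam₁ ∧ lam₂' = lam₂) ∧
      -- `u` is a maximizer
      u ∈ classC p q A B ∧
      (∀ v ∈ classC p q A B, varObj β v ≤ varObj β u) ∧
      -- and it is the unique maximizer up to a.e. equality
      (∀ v ∈ classC p q A B, varObj β v = varObj β u →
        ∀ᵐ t ∂(volume.restrict (Ioi (0 : ℝ))), v t = u t)) := by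
  have hg : 0 < 1 / (2 * β + 1) := by positivity
  have hg1 : 1 / (2 * β + 1) < 1 := by
    rw [div_lt_one (by linarith)]; linarith
  have h₁ : q ≤ (p - 1) * (1 / (2 * β + 1)) ∨ (p - 1) * (1 / (2 * β + 1)) < q ∧
      B * (p * profileMoment (1 / (2 * β + 1)) p q p 0) ^ (1 / p) <
        A * (q * profileMoment (1 / (2 * β + 1)) p q q 0) ^ (1 / q) := by
    rw [← alphaC_eq]
    rcases le_or_gt q (alphaC β p) with h | h
    · exact Or.inl h
    · exact Or.inr ⟨h, moment_ratio_zero_lt hβ hp hq hA h (hreg₁.resolve_left h.not_ge)⟩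
  have h₂ : p ≤ (q - 1) * (1 / (2 * β + 1)) ∨ (q - 1) * (1 / (2 * β + 1)) < p ∧
      A * (q * profileMoment (1 / (2 * β + 1)) q p q 0) ^ (1 / q) <
        B * (p * profileMoment (1 / (2 * β + 1)) q p p 0) ^ (1 / p) := by
    rw [← alphaC_eq]
    rcases le_or_gt p (alphaC β q) with h | h
    · exact Or.inl h
    · refine Or.inr ⟨h, moment_ratio_zero_lt hβ hq hp hB h ?_⟩
      have hr := hreg₂.resolve_left h.not_ge
      rw [rOne_eq_inv_rTwo hβ hq h] at hr
      have hpos : 0 < rTwo β q p := by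
        have hpi := pi_pos
        have hσ : 0 < sigmaC β q := div_pos (by linarith) (by positivity)
        have hα : 0 < alphaC β q / (p - alphaC β q) :=
          div_pos (div_pos (by linarith) (by linarith)) (by linarith)
        unfold rTwo
        positivity
      rw [← inv_div]
      exact inv_lt_of_inv_lt₀ hpos hr
  obtain ⟨a, b, ha, hb, hIp, hIq⟩ := exists_profile_params hg hg1 hp hq hA hB h₁ h₂
  have hopt := fun v hv => profile_optimal hβ hp hq ha hb hA hB hIp hIq (v := v) hv
  have hmem := profile_mem_classC hg hp hq ha hb hA hB hIp hIq
  refine ⟨a, b, ha, hb, hIp, hIq, fun a' b' ha' hb' hIp' hIq' => ?_, hmem,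
    fun v hv => (hopt v hv).1, fun v hv => (hopt v hv).2⟩
  have hmem' := profile_mem_classC hg hp hq ha' hb' hA hB hIp' hIq'
  have heq := (hopt _ hmem').1.antisymm
    (profile_optimal hβ hp hq ha' hb' hA hB hIp' hIq' hmem).1
  exact profile_params_unique hg hp hq hpq ha hb ha' hb' ((hopt _ hmem').2 heq)

end
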